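/- Let Ω ⊂ 𝕂ⁿ be a bounded domain satisfying the uniform interior sphere condition, where 𝕂 = ℝ or 𝕂 = ℂ. (a) If 𝕂 = ℂ, then the closure Ω̄ has local HCP with the optimal Hölder exponent μ = 1 and of order q = 1. (b) If 𝕂 = ℝ and ℝⁿ is identified with ℝⁿ + i·0 ⊂ ℂⁿ, then Ω̄ has local HCP with the optimal exponent μ = 1/2 and of order q = 2. -/

import Mathlib

open Metric Filter Topology

noncomputable section

/-- `u` is plurisubharmonic on `U`: it is upper semicontinuous on `U` and satisfies
the sub-mean value inequality on the boundary circles of all complex discs contained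
in `U`. -/
def PshOn {V : Type*} [NormedAddCommGroup V] [NormedSpace ℂ V]
    (U : Set V) (u : V → ℝ) : Prop :=
  UpperSemicontinuousOn u U ∧
    ∀ a ∈ U, ∀ b : V, ∀ r : ℝ, 0 < r →
      (∀ τ : ℂ, ‖τ‖ ≤ r → a + τ • b ∈ U) →
      u a ≤ (2 * Real.pi)⁻¹ *
        ∫ θ in (0:ℝ)..(2 * Real.pi),
          u (a + ((r : ℂ) * Complex.exp ((θ : ℂ) * Complex.I)) • b)

/-- The local potential `ρ(z) = (1/2) log(1 + ‖z‖²)` of the Fubini–Study form on `ℂⁿ`. -/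
def fsPot {V : Type*} [NormedAddCommGroup V] [NormedSpace ℂ V] (z : V) : ℝ :=
  (1 / 2) * Real.log (1 + ‖z‖ ^ 2)

/-- The Lelong class `ℒ` of plurisubharmonic functions on `ℂⁿ` with logarithmic
growth: `f − (1/2) log(1 + ‖z‖²)` is bounded above. -/
def LelongClass (V : Type*) [NormedAddCommGroup V] [NormedSpace ℂ V] : Set (V → ℝ) :=
  {f | PshOn Set.univ f ∧ ∃ c : ℝ, ∀ z : V, f z ≤ fsPot z + c}

/-- The Siciak–Zaharjuta extremal function
`L_E(z) = sup { f(z) : f ∈ ℒ, f ≤ 0 on E }`. -/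
def siciakExt {V : Type*} [NormedAddCommGroup V] [NormedSpace ℂ V]
    (E : Set V) : V → ℝ := fun z =>
  sSup ((fun f : V → ℝ => f z) '' {f | f ∈ LelongClass V ∧ ∀ x ∈ E, f x ≤ 0})

/-- The extremal function `V_E` of `E ⊆ ℂⁿ ⊆ ℙⁿ` with respect to the Fubini–Study
metric `ω`, read on the affine chart `ℂⁿ` through the standard one-to-one
correspondence `PSH(ℙⁿ, ω) ∋ v ↦ v + fsPot ∈ ℒ`; thus `V_E = L_{E, fsPot} − fsPot`. -/
def VFS {V : Type*} [NormedAddCommGroup V] [NormedSpace ℂ V]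
    (E : Set V) : V → ℝ := fun z =>
  sSup ((fun f : V → ℝ => f z - fsPot z) ''
    {f | f ∈ LelongClass V ∧ ∀ x ∈ E, f x ≤ fsPot x})

/-- `E` is non-pluripolar: equivalently (`V_E^* ≢ +∞`, resp. `L_E^* ≢ +∞`), the
defining family of `V_E` is uniformly bounded from above. -/
def NonPluripolar {V : Type*} [NormedAddCommGroup V] [NormedSpace ℂ V]
    (E : Set V) : Prop :=
  ∃ C : ℝ, ∀ f ∈ LelongClass V, (∀ x ∈ E, f x ≤ 0) → ∀ z : V, f z ≤ fsPot z + C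

/-- The standard embedding `ℝⁿ ≃ ℝⁿ + i·0 ⊆ ℂⁿ`. -/
def embRC {n : ℕ} (x : EuclideanSpace ℝ (Fin n)) : EuclideanSpace ℂ (Fin n) :=
  (WithLp.equiv 2 (Fin n → ℂ)).symm fun i => (x i : ℂ)

/-- `K ⊆ ℂⁿ` has local HCP with exponent `μ` and of order `q`: there are `C > 0`
and `0 < r₀ ≤ 1`, independent of the point, such that
`ϖ′_{K ∩ B(a,r)}(a, δ) ≤ C δ^μ / r^q` for all `a ∈ K`, `0 < δ ≤ 1`, `0 < r < r₀`. -/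
def LocalHCPWith {n : ℕ} (K : Set (EuclideanSpace ℂ (Fin n))) (μ q : ℝ) : Prop :=
  ∃ C : ℝ, 0 < C ∧ ∃ r₀ : ℝ, 0 < r₀ ∧ r₀ ≤ 1 ∧
    ∀ a ∈ K, ∀ r : ℝ, 0 < r → r < r₀ → ∀ δ : ℝ, 0 < δ → δ ≤ 1 →
      ∀ z, dist z a ≤ δ → siciakExt (K ∩ closedBall a r) z ≤ C * δ ^ μ / r ^ q

/-- A bounded domain `Ω ⊆ 𝕂ⁿ` satisfies the uniform interior sphere condition if
there is `r > 0` such that for each `a ∈ ∂Ω` there is a closed ball `B(a', r) ⊆ Ω̄`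
with `B(a', r) ∩ (𝕂ⁿ \ Ω) = {a}`. -/
def UniformInteriorSphere {V : Type*} [NormedAddCommGroup V] (Ω : Set V) : Prop :=
  ∃ r : ℝ, 0 < r ∧ ∀ a ∈ frontier Ω, ∃ a' : V,
    a ∈ closedBall a' r ∧ closedBall a' r ∩ Ωᶜ = {a}

open InnerProductSpace Real

/-- A nonnegative, everywhere finite subharmonic function on the complex plane. -/
structure NonnegSubharmonic (u : ℂ → ℝ) : Prop where
  upperSemicontinuous : UpperSemicontinuous u
  nonneg : ∀ z, 0 ≤ u z
  le_circleAverage : ∀ z r, 0 < r → u z ≤ circleAverage u z r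

lemma UpperSemicontinuous.circleIntegrable_of_nonneg {u : ℂ → ℝ} (hu : UpperSemicontinuous u)
    (h0 : ∀ z, 0 ≤ u z) (c : ℂ) (r : ℝ) : CircleIntegrable u c r := by
  obtain ⟨M, hM⟩ := (hu.upperSemicontinuousOn (sphere c |r|)).bddAbove_of_isCompact
    (isCompact_sphere c |r|)
  refine IntervalIntegrable.mono_fun' (g := fun _ ↦ M) intervalIntegrable_const
    (hu.measurable.comp (measurable_circleMap c r)).aestronglyMeasurable ?_
  refine Eventually.of_forall fun θ ↦ ?_
  refine (Real.norm_of_nonneg (h0 _)).trans_le (hM ⟨_, circleMap_mem_sphere' c r θ, rfl⟩)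

namespace NonnegSubharmonic

variable {u : ℂ → ℝ}

lemma circleIntegrable (hu : NonnegSubharmonic u) (c : ℂ) (r : ℝ) : CircleIntegrable u c r :=
  hu.upperSemicontinuous.circleIntegrable_of_nonneg hu.nonneg c r

/-- The positive part of `u - m` is again subharmonic. -/
lemma posPart_sub_const (hu : NonnegSubharmonic u) (m : ℝ) :
    NonnegSubharmonic fun z ↦ max (u z - m) 0 := by
  have husc : UpperSemicontinuous fun z ↦ max (u z - m) 0 := by
    refine UpperSemicontinuous.sup ?_ upperSemicontinuous_const
    simpa only [sub_eq_add_neg] using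
      hu.upperSemicontinuous.add (upperSemicontinuous_const (z := -m))
  refine ⟨husc, fun z ↦ le_max_right _ _, fun z r hr ↦ max_le ?_ ?_⟩
  · have hi := husc.circleIntegrable_of_nonneg (fun z ↦ le_max_right _ _) z r
    have hc : CircleIntegrable (fun _ ↦ m) z r := circleIntegrable_const m z r
    calc u z - m ≤ circleAverage u z r - circleAverage (fun _ ↦ m) z r := by
          rw [circleAverage_const]; linarith [hu.le_circleAverage z r hr]
      _ = circleAverage (u - fun _ ↦ m) z r :=
          (circleAverage_sub (hu.circleIntegrable z r) hc).symm
      _ ≤ _ := circleAverage_mono ((hu.circleIntegrable z r).sub hc) hi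
          fun w _ ↦ le_max_left _ _
  · exact circleAverage_nonneg_of_nonneg fun w _ ↦ le_max_right _ _

/-- Comparison on a disc with a harmonic majorant defined off a closed set. -/
lemma le_of_harmonicOnNhd_compl (hu : NonnegSubharmonic u) {S : Set ℂ} (hS : IsClosed S)
    {g : ℂ → ℝ} (hg : HarmonicOnNhd g Sᶜ) (hg0 : ∀ z ∉ S, 0 ≤ g z) (huS : ∀ z ∈ S, u z ≤ 0)
    {R : ℝ} (hR : ∀ z ∉ S, ‖z‖ = R → u z ≤ g z) {z : ℂ} (hz : z ∉ S) (hzR : ‖z‖ ≤ R) :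
    u z ≤ g z := by
  classical
  by_contra! hlt
  set F : ℂ → ℝ := fun w ↦ u w - if w ∈ S then 0 else g w with hF
  have hFS : ∀ w ∈ S, F w = u w := fun w hw ↦ by simp [hF, hw]
  have hFc : ∀ w ∉ S, F w = u w - g w := fun w hw ↦ by simp [hF, hw]
  have hFusc : UpperSemicontinuous F := by
    intro w
    by_cases hw : w ∈ S
    · intro y hy
      rw [hFS w hw] at hy
      filter_upwards [hu.upperSemicontinuous w y hy] with v hv
      by_cases hvS : v ∈ S
      · rwa [hFS v hvS]
      · rw [hFc v hvS]; linarith [hg0 v hvS]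
    · have h1 : UpperSemicontinuousAt (fun v ↦ u v + -g v) w :=
        UpperSemicontinuousAt.add (hu.upperSemicontinuous w)
          (ContinuousAt.upperSemicontinuousAt (hg w hw).1.continuousAt.neg)
      intro y hy
      rw [hFc w hw, sub_eq_add_neg] at hy
      filter_upwards [h1 y hy, hS.isOpen_compl.mem_nhds hw] with v hv hvS
      rwa [hFc v hvS, sub_eq_add_neg]
  have hm : 0 < F z := by rw [hFc z hz]; linarith
  set η : ℝ := F z / (2 * (R ^ 2 + 1)) with hη
  have hη0 : 0 < η := by positivity
  have hηR : η * R ^ 2 < F z := by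
    rw [hη, div_mul_eq_mul_div, div_lt_iff₀ (by positivity)]
    nlinarith [sq_nonneg R]
  have hG : UpperSemicontinuous fun w ↦ F w + η * ‖w‖ ^ 2 :=
    hFusc.add (Continuous.upperSemicontinuous (by fun_prop))
  obtain ⟨q, hqR, hq⟩ := (hG.upperSemicontinuousOn (closedBall 0 R)).exists_isMaxOn
    ⟨z, by simpa using hzR⟩ (isCompact_closedBall 0 R)
  have hqR' : ‖q‖ ≤ R := by simpa using hqR
  have hmax : ∀ w, ‖w‖ ≤ R → F w + η * ‖w‖ ^ 2 ≤ F q + η * ‖q‖ ^ 2 := fun w hw ↦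
    hq (by simpa using hw)
  have hFq : 0 < F q := by
    have h1 := hmax z hzR
    have h2 : ‖q‖ ^ 2 ≤ R ^ 2 := by gcongr
    nlinarith [sq_nonneg ‖z‖, mul_nonneg hη0.le (sq_nonneg ‖z‖),
      mul_le_mul_of_nonneg_left h2 hη0.le]
  have hqS : q ∉ S := fun h ↦ by rw [hFS q h] at hFq; linarith [huS q h]
  have hqlt : ‖q‖ < R := lt_of_le_of_ne hqR' fun h ↦ by
    rw [hFc q hqS] at hFq; linarith [hR q hqS h]
  obtain ⟨r, hr, hball⟩ := nhds_basis_closedBall.mem_iff.1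
    ((hS.isOpen_compl.inter isOpen_ball).mem_nhds
      (show q ∈ Sᶜ ∩ ball 0 R from ⟨hqS, by simpa using hqlt⟩))
  have hr' : |r| = r := abs_of_pos hr
  -- on the circle, `‖w‖ ^ 2` agrees with a harmonic function of value `r ^ 2 + ‖q‖ ^ 2` at `q`
  set L : ℂ → ℝ := fun w ↦ (2 * (starRingEnd ℂ q * (w - q))).re with hL
  set H : ℂ → ℝ := (g - η • (fun _ ↦ r ^ 2)) - η • L + fun _ ↦ F q with hH
  have hHharm : HarmonicOnNhd H (closedBall q |r|) := by
    rw [hr']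
    have hLh : HarmonicOnNhd L (closedBall q r) := fun w _ ↦
      AnalyticAt.harmonicAt_re (f := fun w ↦ 2 * (starRingEnd ℂ q * (w - q))) (by fun_prop)
    exact (((hg.mono fun w hw ↦ (hball hw).1).sub
      ((harmonicOnNhd_const _).const_smul)).sub hLh.const_smul).add (harmonicOnNhd_const _)
  have havg := hHharm.circleAverage_eq
  have hHi : CircleIntegrable H q r :=
    (hHharm.continuousOn.mono sphere_subset_closedBall).circleIntegrable'
  have hle : circleAverage u q r ≤ circleAverage H q r := by
    refine circleAverage_mono (hu.circleIntegrable q r) hHi fun w hw ↦ ?_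
    rw [hr'] at hw
    have hwb := hball (sphere_subset_closedBall hw)
    have h1 := hmax w (by simpa using (ball_subset_closedBall hwb.2))
    rw [hFc w hwb.1] at h1
    have h2 : ‖w‖ ^ 2 = r ^ 2 + L w + ‖q‖ ^ 2 := by
      have h3 : ‖w - q‖ ^ 2 = r ^ 2 := by rw [mem_sphere_iff_norm.1 hw]
      rw [← h3]
      simp only [hL, ← Complex.normSq_eq_norm_sq, Complex.normSq_apply]
      simp
      ring
    simp only [hH, Pi.add_apply, Pi.sub_apply, Pi.smul_apply, smul_eq_mul]
    rw [h2] at h1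
    nlinarith
  have hval : H q = g q - η * r ^ 2 + F q := by simp [hH, hL]
  have h4 := hu.le_circleAverage q r hr
  rw [havg, hval, hFc q hqS] at hle
  nlinarith [mul_pos hη0 (pow_pos hr 2)]

/-- Comparison on the plane for a subharmonic function of logarithmic growth. -/
lemma le_of_harmonicOnNhd_compl_of_log_growth (hu : NonnegSubharmonic u) {c : ℝ}
    (hc : ∀ z, u z ≤ Real.log (1 + ‖z‖) + c) {S : Set ℂ} (hS : IsClosed S)
    {g : ℂ → ℝ} (hg : HarmonicOnNhd g Sᶜ) (hg0 : ∀ z ∉ S, 0 ≤ g z) (huS : ∀ z ∈ S, u z ≤ 0)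
    (hlog : ∀ z ∉ S, Real.log ‖z‖ ≤ g z) {z : ℂ} (hz : z ∉ S) :
    u z ≤ g z := by
  have key : ∀ ε > 0, u z ≤ (1 + ε) * g z := by
    intro ε hε
    obtain ⟨R, hR1, hRz, hR⟩ := ((eventually_ge_atTop 1).and ((eventually_ge_atTop ‖z‖).and
      ((Real.tendsto_log_atTop.const_mul_atTop hε).eventually_ge_atTop
        (Real.log 2 + c)))).exists
    refine hu.le_of_harmonicOnNhd_compl hS (g := (1 + ε) • g) hg.const_smul
      (fun w hw ↦ mul_nonneg (by positivity) (hg0 w hw)) huS (R := R) (fun w hw hwR ↦ ?_) hz hRz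
    have h1 := hlog w hw
    have h2 := hc w
    rw [hwR] at h1 h2
    have h3 : Real.log (1 + R) ≤ Real.log 2 + Real.log R := by
      rw [← Real.log_mul (by norm_num) (by positivity)]
      exact Real.log_le_log (by positivity) (by linarith)
    simp only [Pi.smul_apply, smul_eq_mul]
    nlinarith
  have ht : Tendsto (fun ε : ℝ ↦ (1 + ε) * g z) (𝓝[>] 0) (𝓝 ((1 + 0) * g z)) :=
    (Continuous.tendsto (by fun_prop) 0).mono_left nhdsWithin_le_nhds
  rw [add_zero, one_mul] at ht
  exact ge_of_tendsto ht (eventually_mem_nhdsWithin.mono key)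

end NonnegSubharmonic

/-- The segment `[-1, 1]` in the complex plane. -/
def unitSegment : Set ℂ := {w | w.im = 0 ∧ |w.re| ≤ 1}

lemma isClosed_unitSegment : IsClosed unitSegment :=
  (isClosed_eq Complex.continuous_im continuous_const).inter
    (isClosed_le Complex.continuous_re.abs continuous_const)

/-- The holomorphic branch of `√(1 - w⁻²)` off `[-1, 1]` with nonnegative real part. -/
def joukowskiSqrt (w : ℂ) : ℂ := Complex.exp (Complex.log (1 - (w ^ 2)⁻¹) / 2)

/-- The inverse of the Joukowski map, from the complement of `[-1, 1]` to the exterior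
of the unit disc. -/
def joukowskiInv (w : ℂ) : ℂ := w * (1 + joukowskiSqrt w)

/-- The Green function of the complement of `[-1, 1]` with pole at infinity. -/
def segmentGreen (w : ℂ) : ℝ := Real.log ‖joukowskiInv w‖

lemma joukowskiSqrt_re_nonneg (w : ℂ) : 0 ≤ (joukowskiSqrt w).re := by
  rw [joukowskiSqrt, Complex.exp_re]
  refine mul_nonneg (Real.exp_pos _).le (Real.cos_nonneg_of_mem_Icc ⟨?_, ?_⟩)
  · have := Complex.neg_pi_lt_log_im (1 - (w ^ 2)⁻¹)
    rw [Complex.div_ofNat_im]; linarith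
  · have := Complex.log_im_le_pi (1 - (w ^ 2)⁻¹)
    rw [Complex.div_ofNat_im]; linarith

section

variable {w : ℂ}

lemma ne_zero_of_notMem_unitSegment (hw : w ∉ unitSegment) : w ≠ 0 := by
  rintro rfl
  exact hw (by simp [unitSegment])

lemma one_sub_inv_sq_mem_slitPlane (hw : w ∉ unitSegment) :
    1 - (w ^ 2)⁻¹ ∈ Complex.slitPlane := by
  have hw0 := ne_zero_of_notMem_unitSegment hw
  by_contra h
  rw [Complex.mem_slitPlane_iff, not_or, not_not, not_lt] at h
  obtain ⟨h1, h2⟩ := h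
  set v := (w ^ 2)⁻¹ with hv
  have hvre : 1 ≤ v.re := by simpa using h1
  have hvim : v.im = 0 := by simpa using h2
  have hvw : w ^ 2 * v = 1 := mul_inv_cancel₀ (pow_ne_zero 2 hw0)
  have e1 := congrArg Complex.re hvw
  have e2 := congrArg Complex.im hvw
  simp only [pow_two, Complex.mul_re, Complex.mul_im, hvim, Complex.one_re, Complex.one_im] at e1 e2
  have e3 : w.re * w.im = 0 := by
    have : (w.re * w.im) * (2 * v.re) = 0 := by linarith
    exact (mul_eq_zero.1 this).resolve_right (by positivity)
  have e4 : (w.re * w.re - w.im * w.im) * v.re = 1 := by linarith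
  apply hw
  rcases mul_eq_zero.1 e3 with h | h
  · rw [h] at e4
    nlinarith [mul_nonneg (mul_self_nonneg w.im) (zero_le_one.trans hvre)]
  · refine ⟨h, ?_⟩
    rw [h] at e4
    rw [← sq_le_one_iff_abs_le_one]
    nlinarith [mul_le_mul_of_nonneg_left hvre (mul_self_nonneg w.re)]

lemma joukowskiSqrt_sq (hw : w ∉ unitSegment) : joukowskiSqrt w ^ 2 = 1 - (w ^ 2)⁻¹ := by
  rw [joukowskiSqrt, ← Complex.exp_nat_mul]
  push_cast
  rw [mul_div_cancel₀ _ two_ne_zero,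
    Complex.exp_log (Complex.slitPlane_ne_zero (one_sub_inv_sq_mem_slitPlane hw))]

lemma norm_le_norm_joukowskiInv (w : ℂ) : ‖w‖ ≤ ‖joukowskiInv w‖ := by
  rw [joukowskiInv, norm_mul]
  refine le_mul_of_one_le_right (norm_nonneg _) ?_
  calc (1 : ℝ) ≤ (1 + joukowskiSqrt w).re := by
        simpa using joukowskiSqrt_re_nonneg w
    _ ≤ _ := Complex.re_le_norm _

lemma joukowskiInv_ne_zero (hw : w ∉ unitSegment) : joukowskiInv w ≠ 0 := by
  have := norm_pos_iff.2 (ne_zero_of_notMem_unitSegment hw)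
  exact norm_pos_iff.1 (this.trans_le (norm_le_norm_joukowskiInv w))

lemma joukowskiInv_inv (hw : w ∉ unitSegment) :
    (joukowskiInv w)⁻¹ = w * (1 - joukowskiSqrt w) := by
  have hw0 := ne_zero_of_notMem_unitSegment hw
  refine inv_eq_of_mul_eq_one_right ?_
  have : w ^ 2 * (w ^ 2)⁻¹ = 1 := mul_inv_cancel₀ (pow_ne_zero 2 hw0)
  rw [joukowskiInv]
  linear_combination (-w ^ 2) * joukowskiSqrt_sq hw + this

lemma one_le_norm_joukowskiInv (hw : w ∉ unitSegment) : 1 ≤ ‖joukowskiInv w‖ := by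
  have h1 : ‖(joukowskiInv w)⁻¹‖ ≤ ‖joukowskiInv w‖ := by
    rw [joukowskiInv_inv hw, joukowskiInv, norm_mul, norm_mul]
    gcongr
    rw [← sq_le_sq₀ (norm_nonneg _) (norm_nonneg _), ← Complex.normSq_eq_norm_sq,
      ← Complex.normSq_eq_norm_sq, Complex.normSq_apply, Complex.normSq_apply]
    simp only [Complex.sub_re, Complex.one_re, Complex.sub_im, Complex.one_im, Complex.add_re,
      Complex.add_im]
    nlinarith [joukowskiSqrt_re_nonneg w]
  have h0 := norm_pos_iff.2 (joukowskiInv_ne_zero hw)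
  rw [norm_inv, inv_le_iff_one_le_mul₀ h0] at h1
  nlinarith

lemma segmentGreen_nonneg (hw : w ∉ unitSegment) : 0 ≤ segmentGreen w :=
  Real.log_nonneg (one_le_norm_joukowskiInv hw)

lemma log_norm_le_segmentGreen (hw : w ∉ unitSegment) : Real.log ‖w‖ ≤ segmentGreen w :=
  Real.log_le_log (norm_pos_iff.2 (ne_zero_of_notMem_unitSegment hw)) (norm_le_norm_joukowskiInv w)

lemma harmonicOnNhd_segmentGreen : HarmonicOnNhd segmentGreen unitSegmentᶜ := by
  intro w hw
  have hw0 : w ^ 2 ≠ 0 := pow_ne_zero 2 (ne_zero_of_notMem_unitSegment hw)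
  refine AnalyticAt.harmonicAt_log_norm (f := joukowskiInv) ?_ (joukowskiInv_ne_zero hw)
  have h1 : AnalyticAt ℂ (fun w : ℂ ↦ 1 - (w ^ 2)⁻¹) w :=
    analyticAt_const.sub ((analyticAt_id.pow 2).inv hw0)
  exact analyticAt_id.mul
    (analyticAt_const.add ((h1.clog (one_sub_inv_sq_mem_slitPlane hw)).div_const).cexp)

lemma exists_cosh_segmentGreen (hw : w ∉ unitSegment) : ∃ θ : ℝ,
    w.re = Real.cosh (segmentGreen w) * Real.cos θ ∧
      w.im = Real.sinh (segmentGreen w) * Real.sin θ := by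
  have h : w = Complex.cosh (Complex.log (joukowskiInv w)) := by
    rw [Complex.cosh, Complex.exp_neg, Complex.exp_log (joukowskiInv_ne_zero hw),
      joukowskiInv_inv hw, joukowskiInv]
    ring
  refine ⟨(joukowskiInv w).arg, ?_⟩
  rw [Complex.log, Complex.cosh_add, Complex.cosh_mul_I, Complex.sinh_mul_I] at h
  rw [segmentGreen]
  have e1 := congrArg Complex.re h
  have e2 := congrArg Complex.im h
  rw [← Complex.ofReal_cosh, ← Complex.ofReal_sinh, ← Complex.ofReal_cos, ← Complex.ofReal_sin]
    at e1 e2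
  simp at e1 e2
  simp only [← Complex.ofReal_sinh, ← Complex.ofReal_cos, ← Complex.ofReal_sin,
    Complex.ofReal_re] at e1 e2
  refine ⟨?_, ?_⟩ <;> linarith

lemma segmentGreen_le_sqrt {x : ℝ} (hx : 1 < x) : segmentGreen x ≤ √(2 * (x - 1)) := by
  have hw : (x : ℂ) ∉ unitSegment := fun h ↦ by
    have := h.2
    rw [Complex.ofReal_re, abs_of_pos (by linarith)] at this
    linarith
  obtain ⟨θ, h1, h2⟩ := exists_cosh_segmentGreen hw
  have hG := segmentGreen_nonneg hw
  set G := segmentGreen x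
  rw [Complex.ofReal_re] at h1
  rw [Complex.ofReal_im] at h2
  refine Real.le_sqrt_of_sq_le ?_
  rcases hG.eq_or_lt with hG0 | hG0
  · rw [← hG0]; linarith
  have hsin : Real.sin θ = 0 :=
    (mul_eq_zero.1 h2.symm).resolve_left (Real.sinh_pos_iff.2 hG0).ne'
  have hcosh : x ≤ Real.cosh G := by
    rw [h1]
    exact mul_le_of_le_one_right (Real.cosh_pos G).le (Real.cos_le_one θ)
  have hcosh' : Real.cosh G ≤ x := by
    have hcos : Real.cos θ ^ 2 = 1 := by nlinarith [Real.sin_sq_add_cos_sq θ]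
    rcases (sq_eq_one_iff.1 hcos) with h | h <;> rw [h] at h1 <;> linarith [Real.cosh_pos G]
  have hhalf : G / 2 ≤ Real.sinh (G / 2) := Real.self_le_sinh_iff.2 (by positivity)
  have h3 : Real.cosh G = 1 + 2 * Real.sinh (G / 2) ^ 2 := by
    have := Real.cosh_two_mul (G / 2)
    rw [mul_div_cancel₀ _ two_ne_zero, Real.cosh_sq] at this
    linarith
  nlinarith

lemma segmentGreen_mul_sqrt_le (hw : w ∉ unitSegment) :
    segmentGreen w * √(1 - w.re ^ 2) ≤ |w.im| := by
  obtain ⟨θ, h1, h2⟩ := exists_cosh_segmentGreen hw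
  have hG := segmentGreen_nonneg hw
  set G := segmentGreen w
  have hs : G ≤ Real.sinh G := Real.self_le_sinh_iff.2 hG
  have hc := Real.one_le_cosh G
  rw [h2, abs_mul, abs_of_nonneg (hG.trans hs)]
  gcongr
  rw [← Real.sqrt_sq_eq_abs]
  gcongr
  rw [h1, mul_pow]
  nlinarith [Real.sin_sq_add_cos_sq θ, mul_nonneg (sq_nonneg (Real.cos θ)) (sub_nonneg.2 hc),
    sq_nonneg (Real.cos θ), one_le_pow₀ hc (n := 2)]

end

/-- A nonnegative function of logarithmic growth that is subharmonic on complex lines. -/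
structure NonnegLelong {V : Type*} [NormedAddCommGroup V] [NormedSpace ℂ V] (v : V → ℝ) :
    Prop where
  line : ∀ a b : V, NonnegSubharmonic fun τ : ℂ ↦ v (a + τ • b)
  growth : ∃ c : ℝ, ∀ z, v z ≤ Real.log (1 + ‖z‖) + c

section

variable {V : Type*} [NormedAddCommGroup V] [NormedSpace ℂ V]

lemma fsPot_le_log_one_add_norm (z : V) : fsPot z ≤ Real.log (1 + ‖z‖) := by
  have h : Real.log (1 + ‖z‖ ^ 2) ≤ Real.log ((1 + ‖z‖) ^ 2) :=
    Real.log_le_log (by positivity) (by nlinarith [norm_nonneg z])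
  rw [Real.log_pow] at h
  push_cast at h
  rw [fsPot]
  linarith

/-- The positive part of a function of the Lelong class; where the function is positive, the
sub-mean value inequality forces it to be integrable on circles. -/
lemma nonnegLelong_posPart {f : V → ℝ} (hf : f ∈ LelongClass V) :
    NonnegLelong fun z ↦ max (f z) 0 := by
  obtain ⟨⟨husc, hmean⟩, c, hc⟩ := hf
  refine ⟨fun a b ↦ ?_, max c 0, fun z ↦ ?_⟩
  · have hu : UpperSemicontinuous fun τ : ℂ ↦ max (f (a + τ • b)) 0 :=
      ((upperSemicontinuousOn_univ_iff.1 husc).comp (by fun_prop)).sup upperSemicontinuous_const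
    refine ⟨hu, fun τ ↦ le_max_right _ _, fun τ r hr ↦ max_le ?_ ?_⟩
    · have h1 : f (a + τ • b) ≤ circleAverage (fun τ ↦ f (a + τ • b)) τ r := by
        have := hmean (a + τ • b) (Set.mem_univ _) b r hr fun _ _ ↦ Set.mem_univ _
        simpa only [circleAverage_def, circleMap, add_smul, smul_eq_mul, add_assoc] using this
      by_cases hi : CircleIntegrable (fun τ ↦ f (a + τ • b)) τ r
      · exact h1.trans (circleAverage_mono hi
          (hu.circleIntegrable_of_nonneg (fun _ ↦ le_max_right _ _) τ r)
          fun _ _ ↦ le_max_left _ _)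
      · rw [circleAverage.integral_undef hi] at h1
        exact h1.trans (circleAverage_nonneg_of_nonneg fun _ _ ↦ le_max_right _ _)
    · exact circleAverage_nonneg_of_nonneg fun _ _ ↦ le_max_right _ _
  · refine max_le ((hc z).trans (add_le_add (fsPot_le_log_one_add_norm z) (le_max_left _ _))) ?_
    exact add_nonneg (Real.log_nonneg (by linarith [norm_nonneg z])) (le_max_right _ _)

lemma siciakExt_le {E : Set V} {z : V} {B : ℝ}
    (h : ∀ v : V → ℝ, NonnegLelong v → (∀ x ∈ E, v x ≤ 0) → v z ≤ B) : siciakExt E z ≤ B := by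
  have hB : 0 ≤ B := by
    refine h (fun _ ↦ 0) ⟨fun _ _ ↦ ⟨upperSemicontinuous_const, fun _ ↦ le_rfl, fun _ _ _ ↦ ?_⟩, 0,
      fun z ↦ ?_⟩ fun _ _ ↦ le_rfl
    · rw [circleAverage_const]
    · rw [add_zero]
      exact Real.log_nonneg (by linarith [norm_nonneg z])
  refine Real.sSup_le ?_ hB
  rintro _ ⟨f, ⟨hf, hfE⟩, rfl⟩
  exact (le_max_left _ _).trans
    (h _ (nonnegLelong_posPart hf) fun x hx ↦ max_le (hfE x hx) le_rfl)

namespace NonnegLelong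

variable {v : V → ℝ}

lemma nonneg (hv : NonnegLelong v) (z : V) : 0 ≤ v z := by
  simpa using (hv.line z 0).nonneg 0

lemma posPart_sub_const (hv : NonnegLelong v) {m : ℝ} (hm : 0 ≤ m) :
    NonnegLelong fun z ↦ max (v z - m) 0 := by
  refine ⟨fun a b ↦ (hv.line a b).posPart_sub_const m, ?_⟩
  obtain ⟨c, hc⟩ := hv.growth
  exact ⟨c, fun z ↦ max_le (by linarith [hc z]) ((hv.nonneg z).trans (hc z))⟩

lemma line_growth (hv : NonnegLelong v) (a b : V) :
    ∃ c, ∀ τ : ℂ, v (a + τ • b) ≤ Real.log (1 + ‖τ‖) + c := by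
  obtain ⟨c, hc⟩ := hv.growth
  refine ⟨Real.log (1 + ‖a‖ + ‖b‖) + c, fun τ ↦ (hc _).trans ?_⟩
  rw [← add_assoc, ← Real.log_mul (by positivity) (by positivity)]
  gcongr
  have := norm_add_le a (τ • b)
  rw [norm_smul] at this
  nlinarith [norm_nonneg a, norm_nonneg b, norm_nonneg τ,
    mul_nonneg (norm_nonneg τ) (norm_nonneg a)]

/-- A bound near a complex ball. -/
lemma le_of_nonpos_on_closedBall (hv : NonnegLelong v) {c : V} {s : ℝ} (hs : 0 < s)
    (h0 : ∀ x ∈ closedBall c s, v x ≤ 0) {b z : V} {δ : ℝ} (hb : dist b c ≤ s)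
    (hz : dist z b ≤ δ) : v z ≤ δ / s := by
  by_cases hzc : dist z c ≤ s
  · exact (h0 z hzc).trans (div_nonneg (dist_nonneg.trans hz) hs.le)
  push Not at hzc
  have hρ : 0 < dist z c := hs.trans hzc
  set w : V := ((s / dist z c : ℝ) : ℂ) • (z - c) with hw
  have hwn : ‖w‖ = s := by
    rw [hw, norm_smul, ← dist_eq_norm, Complex.norm_real, Real.norm_of_nonneg (by positivity)]
    field_simp
  obtain ⟨C, hC⟩ := hv.line_growth c w
  have hτ : ‖((dist z c / s : ℝ) : ℂ)‖ = dist z c / s := by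
    rw [Complex.norm_real, Real.norm_of_nonneg (by positivity)]
  have key := (hv.line c w).le_of_harmonicOnNhd_compl_of_log_growth hC
    (S := closedBall 0 1) isClosed_closedBall (g := fun τ ↦ Real.log ‖τ‖)
    (fun τ hτ ↦ AnalyticAt.harmonicAt_log_norm analyticAt_id (by rintro rfl; simp at hτ))
    (fun τ hτ ↦ Real.log_nonneg (by simp at hτ; exact hτ.le))
    (fun τ hτ ↦ h0 _ (by
      rw [mem_closedBall_iff_norm, add_sub_cancel_left, norm_smul, hwn]
      exact mul_le_of_le_one_left hs.le (by simpa using hτ)))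
    (fun _ _ ↦ le_rfl) (z := ((dist z c / s : ℝ) : ℂ)) (by
      rw [mem_closedBall_zero_iff, hτ, not_le, lt_div_iff₀ hs]; linarith)
  have hzeq : c + ((dist z c / s : ℝ) : ℂ) • w = z := by
    rw [hw, smul_smul, ← Complex.ofReal_mul, div_mul_div_cancel₀ hs.ne', div_self hρ.ne']
    simp
  simp only [hzeq, hτ] at key
  refine key.trans ((Real.log_le_sub_one_of_pos (by positivity)).trans ?_)
  rw [div_sub_one hs.ne']
  gcongr
  linarith [dist_triangle z b c]

end NonnegLelong

end

section

variable {n : ℕ}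

lemma embRC_add (x y : EuclideanSpace ℝ (Fin n)) : embRC (x + y) = embRC x + embRC y := by
  ext i; simp [embRC]

lemma embRC_smul (t : ℝ) (x : EuclideanSpace ℝ (Fin n)) :
    embRC (t • x) = (t : ℂ) • embRC x := by
  ext i; simp [embRC]

lemma embRC_zero : embRC (0 : EuclideanSpace ℝ (Fin n)) = 0 := by
  simpa using embRC_smul 0 (0 : EuclideanSpace ℝ (Fin n))

lemma embRC_sub (x y : EuclideanSpace ℝ (Fin n)) : embRC (x - y) = embRC x - embRC y := by
  ext i; simp [embRC]

lemma norm_embRC (x : EuclideanSpace ℝ (Fin n)) : ‖embRC x‖ = ‖x‖ := by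
  simp [EuclideanSpace.norm_eq, embRC]

lemma dist_embRC (x y : EuclideanSpace ℝ (Fin n)) : dist (embRC x) (embRC y) = dist x y := by
  rw [dist_eq_norm, dist_eq_norm, ← embRC_sub, norm_embRC]

lemma exists_eq_embRC_add_I_smul (z : EuclideanSpace ℂ (Fin n)) :
    ∃ x y : EuclideanSpace ℝ (Fin n), z = embRC x + Complex.I • embRC y ∧
      ∀ b, ‖x - b‖ ≤ ‖z - embRC b‖ ∧ ‖y‖ ≤ ‖z - embRC b‖ := by
  refine ⟨WithLp.toLp 2 fun i ↦ (z i).re, WithLp.toLp 2 fun i ↦ (z i).im, ?_, fun b ↦ ⟨?_, ?_⟩⟩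
  · ext i
    simp [embRC, mul_comm Complex.I, Complex.re_add_im]
  · rw [EuclideanSpace.norm_eq, EuclideanSpace.norm_eq]
    gcongr with i
    simpa [embRC] using Complex.abs_re_le_norm (z i - b i)
  · rw [EuclideanSpace.norm_eq, EuclideanSpace.norm_eq]
    gcongr with i
    simpa [embRC] using Complex.abs_im_le_norm (z i - b i)

end

namespace NonnegLelong

variable {n : ℕ} {v : EuclideanSpace ℂ (Fin n) → ℝ}

/-- Comparison with the Green function of a real segment. -/
lemma line_le_segmentGreen (hv : NonnegLelong v) {p e : EuclideanSpace ℝ (Fin n)}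
    (h0 : ∀ t : ℝ, |t| ≤ 1 → v (embRC (p + t • e)) ≤ 0) {w : ℂ} (hw : w ∉ unitSegment) :
    v (embRC p + w • embRC e) ≤ segmentGreen w := by
  obtain ⟨C, hC⟩ := hv.line_growth (embRC p) (embRC e)
  refine (hv.line (embRC p) (embRC e)).le_of_harmonicOnNhd_compl_of_log_growth hC
    isClosed_unitSegment harmonicOnNhd_segmentGreen (fun _ ↦ segmentGreen_nonneg) ?_
    (fun _ ↦ log_norm_le_segmentGreen) hw
  rintro τ ⟨him, hre⟩
  have := h0 τ.re hre
  rwa [embRC_add, embRC_smul, show ((τ.re : ℝ) : ℂ) = τ from Complex.ext rfl him.symm] at this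

/-- A bound at real points near a real ball. -/
lemma le_sqrt_of_nonpos_on_real_ball (hv : NonnegLelong v) {c : EuclideanSpace ℝ (Fin n)} {s : ℝ}
    (hs : 0 < s) (h0 : ∀ x ∈ closedBall c s, v (embRC x) ≤ 0) {x : EuclideanSpace ℝ (Fin n)}
    {h : ℝ} (hx : dist x c ≤ s + h) : v (embRC x) ≤ √(2 * h / s) := by
  by_cases hxs : dist x c ≤ s
  · exact (h0 x hxs).trans (Real.sqrt_nonneg _)
  push Not at hxs
  have hρ : 0 < dist x c := hs.trans hxs
  have h1 : 1 < dist x c / s := (one_lt_div hs).2 hxs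
  have key := hv.line_le_segmentGreen (p := c) (e := (s / dist x c) • (x - c)) (fun t ht ↦ h0 _ (by
    rw [mem_closedBall_iff_norm, add_sub_cancel_left, norm_smul, norm_smul, ← dist_eq_norm,
      Real.norm_of_nonneg (div_pos hs hρ).le, div_mul_cancel₀ _ hρ.ne']
    exact mul_le_of_le_one_left hs.le ht)) (w := ((dist x c / s : ℝ) : ℂ)) (fun hmem ↦ by
      have := hmem.2
      rw [Complex.ofReal_re, abs_of_pos (by positivity)] at this
      linarith)
  rw [← embRC_smul, ← embRC_add, smul_smul, div_mul_div_cancel₀ hs.ne', div_self hρ.ne', one_smul,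
    add_sub_cancel] at key
  refine key.trans ((segmentGreen_le_sqrt h1).trans (Real.sqrt_le_sqrt ?_))
  rw [mul_div_assoc, div_sub_one hs.ne']
  gcongr
  linarith

/-- A bound over interior points of a real ball, along a chord in the imaginary direction. -/
lemma le_div_sqrt_of_nonpos_on_real_ball (hv : NonnegLelong v) {c : EuclideanSpace ℝ (Fin n)}
    {ρ : ℝ} (h0 : ∀ x ∈ closedBall c ρ, v (embRC x) ≤ 0) {x y : EuclideanSpace ℝ (Fin n)}
    (hx : ‖x - c‖ < ρ) :
    v (embRC x + Complex.I • embRC y) ≤ ‖y‖ / √(ρ ^ 2 - ‖x - c‖ ^ 2) := by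
  rcases eq_or_ne y 0 with rfl | hy
  · rw [embRC_zero, smul_zero, add_zero]
    exact (h0 x (by rw [mem_closedBall_iff_norm]; exact hx.le)).trans (by positivity)
  have hyn : 0 < ‖y‖ := norm_pos_iff.2 hy
  set e := ‖y‖⁻¹ • y with he
  have hen : ‖e‖ = 1 := norm_smul_inv_norm hy
  set τ := inner ℝ (x - c) e with hτ
  set p := x - c - τ • e with hp
  have hpe : inner ℝ p e = 0 := by
    rw [hp, inner_sub_left, real_inner_smul_left, real_inner_self_eq_norm_sq, hen, ← hτ]
    ring
  have hpyth : ∀ t : ℝ, ‖p + t • e‖ ^ 2 = ‖p‖ ^ 2 + t ^ 2 := fun t ↦ by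
    rw [norm_add_sq_real, real_inner_smul_right, hpe, norm_smul, hen, Real.norm_eq_abs, mul_one,
      sq_abs]
    ring
  have hxp : ‖x - c‖ ^ 2 = ‖p‖ ^ 2 + τ ^ 2 := by
    rw [← hpyth, hp, sub_add_cancel]
  have hD : 0 < ρ ^ 2 - ‖x - c‖ ^ 2 := by nlinarith [norm_nonneg (x - c)]
  have hρ : 0 ≤ ρ := (norm_nonneg _).trans hx.le
  set L := √(ρ ^ 2 - ‖p‖ ^ 2) with hL
  have hLpos : 0 < ρ ^ 2 - ‖p‖ ^ 2 := by nlinarith [sq_nonneg τ]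
  have hL0 : 0 < L := Real.sqrt_pos.2 hLpos
  have hLsq : L ^ 2 = ρ ^ 2 - ‖p‖ ^ 2 := Real.sq_sqrt hLpos.le
  set w : ℂ := ⟨τ / L, ‖y‖ / L⟩ with hwdef
  have hw : w ∉ unitSegment := fun h ↦ by
    have : ‖y‖ / L = 0 := h.1
    exact (div_pos hyn hL0).ne' this
  have key := hv.line_le_segmentGreen (p := c + p) (e := L • e) (fun t ht ↦ h0 _ (by
    rw [mem_closedBall_iff_norm, add_assoc, add_sub_cancel_left, smul_smul,
      ← sq_le_sq₀ (norm_nonneg _) hρ, hpyth, mul_pow, hLsq]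
    nlinarith [(sq_le_one_iff_abs_le_one t).2 ht])) hw
  have hwL : w * (L : ℂ) = (τ : ℂ) + Complex.I * (‖y‖ : ℂ) := by
    apply Complex.ext <;> simp [hwdef, hL0.ne']
  have hpt : embRC (c + p) + w • embRC (L • e) = embRC x + Complex.I • embRC y := by
    rw [embRC_smul, smul_smul, hwL, add_smul, mul_smul, ← embRC_smul, ← embRC_smul, ← add_assoc,
      ← embRC_add, hp, he, smul_smul ‖y‖, mul_inv_cancel₀ hyn.ne', one_smul]
    congr 2
    abel
  rw [hpt] at key
  refine key.trans ?_
  have h3 := segmentGreen_mul_sqrt_le hw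
  have h4 : 1 - w.re ^ 2 = (ρ ^ 2 - ‖x - c‖ ^ 2) / L ^ 2 := by
    rw [show w.re = τ / L from rfl, hxp]
    field_simp
    rw [hLsq]
    ring
  have h5 : |w.im| = ‖y‖ / L := abs_of_pos (div_pos hyn hL0)
  rw [h4, h5, Real.sqrt_div hD.le, Real.sqrt_sq hL0.le, ← mul_div_assoc,
    div_le_div_iff_of_pos_right hL0] at h3
  exact (le_div_iff₀ (Real.sqrt_pos.2 hD)).2 h3

/-- A bound at complex points near a real ball. -/
lemma le_four_mul_sqrt_of_nonpos_on_real_ball (hv : NonnegLelong v)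
    {b c : EuclideanSpace ℝ (Fin n)} {s : ℝ} (hs : 0 < s)
    (h0 : ∀ x ∈ closedBall c s, v (embRC x) ≤ 0) (hb : dist b c ≤ s)
    {z : EuclideanSpace ℂ (Fin n)} {δ : ℝ} (hδ : 0 < δ) (hz : dist z (embRC b) ≤ δ) :
    v z ≤ 4 * √(δ / s) := by
  obtain ⟨x, y, rfl, hxy⟩ := exists_eq_embRC_add_I_smul z
  obtain ⟨hxb, hyb⟩ := hxy b
  rw [← dist_eq_norm, ← dist_eq_norm] at hxb
  rw [← dist_eq_norm] at hyb
  have hxc : ‖x - c‖ ≤ s + δ := by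
    rw [← dist_eq_norm]
    linarith [dist_triangle x b c, dist_eq_norm x b]
  set m := √(2 * (4 * δ) / s) with hm
  have hm' : m = √8 * √(δ / s) := by
    rw [hm, ← Real.sqrt_mul (by norm_num)]
    congr 1
    ring
  have key := (hv.posPart_sub_const (Real.sqrt_nonneg _ : 0 ≤ m)).le_div_sqrt_of_nonpos_on_real_ball
    (c := c) (ρ := s + 4 * δ)
    (fun x hx ↦ max_le (sub_nonpos.2 (hv.le_sqrt_of_nonpos_on_real_ball hs h0 hx)) le_rfl)
    (x := x) (y := y) (by linarith)
  have h1 : δ * s ≤ (s + 4 * δ) ^ 2 - ‖x - c‖ ^ 2 := by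
    have : ‖x - c‖ ^ 2 ≤ (s + δ) ^ 2 := by gcongr
    nlinarith [mul_pos hδ hs]
  have h2 : ‖y‖ / √((s + 4 * δ) ^ 2 - ‖x - c‖ ^ 2) ≤ √(δ / s) := by
    calc _ ≤ δ / √(δ * s) := by
          gcongr
          exact hyb.trans hz
      _ = √(δ / s) := by
          rw [div_eq_iff (Real.sqrt_pos.2 (by positivity)).ne', ← Real.sqrt_mul (by positivity),
            div_mul_eq_mul_div, ← mul_assoc, mul_div_cancel_right₀ _ hs.ne',
            Real.sqrt_mul_self hδ.le]
  have h3 : √8 ≤ 3 := Real.sqrt_le_iff.2 ⟨by norm_num, by norm_num⟩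
  have h4 := (le_max_left _ _).trans (key.trans h2)
  nlinarith [Real.sqrt_nonneg (δ / s)]

/-- A two-constants estimate: smallness on a real ball and boundedness on the complex ball. -/
lemma le_of_nonpos_on_real_ball_of_le (hv : NonnegLelong v) {a : EuclideanSpace ℝ (Fin n)}
    {d M : ℝ} (hd : 0 < d) (h0 : ∀ x ∈ closedBall a d, v (embRC x) ≤ 0)
    (hM : ∀ z ∈ closedBall (embRC a) d, v z ≤ M) {z : EuclideanSpace ℂ (Fin n)} {δ : ℝ}
    (hδ : δ ≤ d / 4) (hz : dist z (embRC a) ≤ δ) : v z ≤ 8 * M * δ / d := by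
  have hM0 : 0 ≤ M := (hv.nonneg _).trans (hM (embRC a) (mem_closedBall_self hd.le))
  have hδ0 : 0 ≤ δ := dist_nonneg.trans hz
  rw [dist_eq_norm] at hz
  obtain ⟨x, y, rfl, hxy⟩ := exists_eq_embRC_add_I_smul z
  obtain ⟨hxa, hya⟩ := hxy a
  replace hxa := hxa.trans hz
  replace hya := hya.trans hz
  rcases eq_or_ne y 0 with rfl | hy
  · rw [embRC_zero, smul_zero, add_zero]
    exact (h0 x (by rw [mem_closedBall_iff_norm]; linarith)).trans (by positivity)
  have hyn : 0 < ‖y‖ := norm_pos_iff.2 hy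
  set e := (d / 4 * ‖y‖⁻¹) • y with he
  have hen : ‖e‖ = d / 4 := by
    rw [he, norm_smul, Real.norm_of_nonneg (by positivity), mul_assoc, inv_mul_cancel₀ hyn.ne',
      mul_one]
  set w : ℂ := ⟨0, ‖y‖ / (d / 4)⟩ with hwdef
  have hw : w ∉ unitSegment := fun h ↦ by
    have : ‖y‖ / (d / 4) = 0 := h.1
    exact (by positivity : (0:ℝ) < ‖y‖ / (d / 4)).ne' this
  have hwI : w = Complex.I * ((‖y‖ / (d / 4) : ℝ) : ℂ) := by
    apply Complex.ext <;> simp only [hwdef, Complex.I_mul_re, Complex.I_mul_im, Complex.ofReal_re,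
      Complex.ofReal_im, neg_zero]
  have hwn : ‖w‖ ≤ 2 := by
    rw [hwI, norm_mul, Complex.norm_I, one_mul, Complex.norm_real,
      Real.norm_of_nonneg (by positivity), div_le_iff₀ (by positivity)]
    linarith
  have hlog : 0 < Real.log 2 := Real.log_pos one_lt_two
  have key := (hv.line (embRC x) (embRC e)).le_of_harmonicOnNhd_compl isClosed_unitSegment
    (g := (M / Real.log 2) • segmentGreen) harmonicOnNhd_segmentGreen.const_smul
    (fun τ hτ ↦ mul_nonneg (by positivity) (segmentGreen_nonneg hτ)) (by
      rintro τ ⟨him, hre⟩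
      rw [show τ = ((τ.re : ℝ) : ℂ) from Complex.ext rfl him, ← embRC_smul, ← embRC_add]
      refine h0 _ ?_
      rw [mem_closedBall_iff_norm, add_sub_right_comm]
      refine (norm_add_le _ _).trans ?_
      rw [norm_smul, hen, Real.norm_eq_abs]
      nlinarith) (R := 2) (fun τ hτ hτ2 ↦ by
      have h1 := log_norm_le_segmentGreen hτ
      rw [hτ2] at h1
      calc v (embRC x + τ • embRC e) ≤ M := hM _ (by
            rw [mem_closedBall_iff_norm, add_sub_right_comm, ← embRC_sub]
            refine (norm_add_le _ _).trans ?_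
            rw [norm_smul, norm_embRC, norm_embRC, hen, hτ2]
            linarith)
        _ = M / Real.log 2 * Real.log 2 := by field_simp
        _ ≤ M / Real.log 2 * segmentGreen τ := by gcongr) hw hwn
  have hpt : embRC x + w • embRC e = embRC x + Complex.I • embRC y := by
    rw [hwI, mul_smul, ← embRC_smul, he, smul_smul]
    congr 3
    rw [show ‖y‖ / (d / 4) * (d / 4 * ‖y‖⁻¹) = 1 by field_simp, one_smul]
  have h3 := segmentGreen_mul_sqrt_le hw
  rw [show w.re = 0 from rfl, show |w.im| = ‖y‖ / (d / 4) from abs_of_pos (by positivity)] at h3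
  simp only [hpt, Pi.smul_apply, smul_eq_mul] at key
  norm_num at h3
  have h4 : segmentGreen w ≤ 4 * δ / d := h3.trans (by
    rw [div_le_div_iff₀ (by positivity) hd]; nlinarith)
  have h5 : M / Real.log 2 ≤ 2 * M := by
    rw [div_le_iff₀ hlog]
    nlinarith [Real.log_two_gt_d9]
  calc _ ≤ _ := key
    _ ≤ 2 * M * (4 * δ / d) := by gcongr; exact segmentGreen_nonneg hw
    _ = _ := by ring

end NonnegLelong

/-- Either a ball lies in an open set, or the centre has a nearest point on the boundary,
whose distance ball lies in the closure. -/
lemma closedBall_subset_or_exists_frontier {V : Type*} [NormedAddCommGroup V] [NormedSpace ℝ V]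
    [ProperSpace V] {Ω : Set V} (hΩ : IsOpen Ω) {a : V} (ha : a ∈ closure Ω) (t : ℝ) :
    closedBall a t ⊆ Ω ∨
      ∃ b ∈ frontier Ω, dist a b ≤ t ∧ closedBall a (dist a b) ⊆ closure Ω := by
  refine or_iff_not_imp_left.2 fun h ↦ ?_
  obtain ⟨y, hyt, hy⟩ := Set.not_subset.1 h
  obtain ⟨b, hb, hab⟩ := hΩ.isClosed_compl.exists_infDist_eq_dist ⟨y, hy⟩ a
  have hball : ball a (dist a b) ⊆ Ω := fun x hx ↦ by
    by_contra hxΩ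
    have := infDist_le_dist_of_mem (x := a) (show x ∈ Ωᶜ from hxΩ)
    rw [hab, dist_comm a x] at this
    exact absurd hx (not_lt.2 this)
  have hcball : closedBall a (dist a b) ⊆ closure Ω := by
    rcases eq_or_ne (dist a b) 0 with h0 | h0
    · rw [h0, closedBall_zero]
      exact Set.singleton_subset_iff.2 ha
    · rw [← closure_ball a h0]
      exact closure_mono hball
  refine ⟨b, ?_, ?_, hcball⟩
  · rw [hΩ.frontier_eq]
    exact ⟨hcball (by rw [mem_closedBall, dist_comm]), hb⟩
  · rw [← hab]
    exact (infDist_le_dist_of_mem (show y ∈ Ωᶜ from hy)).trans (by rwa [dist_comm])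

/-- The interior sphere condition provides arbitrarily small balls in the closure. -/
lemma UniformInteriorSphere.exists_closedBall {V : Type*} [NormedAddCommGroup V]
    [NormedSpace ℝ V] {Ω : Set V} (h : UniformInteriorSphere Ω) :
    ∃ ρ > 0, ∀ b ∈ frontier Ω, ∀ s, 0 < s → s ≤ ρ →
      ∃ c, dist b c ≤ s ∧ closedBall c s ⊆ closure Ω := by
  obtain ⟨ρ, hρ, h⟩ := h
  refine ⟨ρ, hρ, fun b hb s hs hsρ ↦ ?_⟩
  obtain ⟨b', hbb', hinter⟩ := h b hb
  rw [mem_closedBall, dist_eq_norm] at hbb'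
  have hsub : closedBall b' ρ ⊆ closure Ω := fun x hx ↦ by
    by_cases hxΩ : x ∈ Ω
    · exact subset_closure hxΩ
    · have : x ∈ ({b} : Set V) := hinter ▸ ⟨hx, hxΩ⟩
      rw [Set.mem_singleton_iff.1 this]
      exact frontier_subset_closure hb
  have hsr : s / ρ ≤ 1 := (div_le_one hρ).2 hsρ
  refine ⟨b + (s / ρ) • (b' - b), ?_, (closedBall_subset_closedBall' ?_).trans hsub⟩
  · rw [dist_eq_norm, sub_add_cancel_left, norm_neg, norm_smul, norm_sub_rev,
      Real.norm_of_nonneg (by positivity)]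
    calc s / ρ * ‖b - b'‖ ≤ s / ρ * ρ := by gcongr
      _ = s := div_mul_cancel₀ _ hρ.ne'
  · have : b + (s / ρ) • (b' - b) - b' = (1 - s / ρ) • (b - b') := by module
    rw [dist_eq_norm, this, norm_smul, Real.norm_of_nonneg (by linarith)]
    calc s + (1 - s / ρ) * ‖b - b'‖ ≤ s + (1 - s / ρ) * ρ := by
          gcongr
      _ = ρ := by field_simp; ring

lemma localHCPWith_closure_complex {n : ℕ} {Ω : Set (EuclideanSpace ℂ (Fin n))} (hΩ : IsOpen Ω)
    (h : UniformInteriorSphere Ω) : LocalHCPWith (closure Ω) 1 1 := by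
  let _ : NormedSpace ℝ (EuclideanSpace ℂ (Fin n)) := NormedSpace.restrictScalars ℝ ℂ _
  obtain ⟨ρ, hρ, hball⟩ := h.exists_closedBall
  refine ⟨8, by norm_num, min 1 ρ, lt_min one_pos hρ, min_le_left _ _, ?_⟩
  intro a ha r hr hrρ δ hδ _ z hz
  have hrρ' : r < ρ := hrρ.trans_le (min_le_right _ _)
  rw [Real.rpow_one, Real.rpow_one]
  refine siciakExt_le fun v hv hv0 ↦ ?_
  rcases closedBall_subset_or_exists_frontier hΩ ha (r / 2) with hsub | ⟨b, hb, hab, hsub⟩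
  · calc v z ≤ δ / (r / 2) := hv.le_of_nonpos_on_closedBall (by positivity) (fun x hx ↦
          hv0 x ⟨subset_closure (hsub hx), closedBall_subset_closedBall (by linarith) hx⟩)
          (b := a) (by rw [dist_self]; positivity) hz
      _ = 2 * δ / r := by field_simp
      _ ≤ 8 * δ / r := by gcongr; norm_num
  · obtain hlt | hle := lt_or_ge δ (dist a b)
    · exact (hv0 z ⟨hsub (hz.trans hlt.le), hz.trans (by linarith)⟩).trans (by positivity)
    · obtain ⟨c, hbc, hcsub⟩ := hball b hb (r / 4) (by positivity) (by linarith)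
      calc v z ≤ (2 * δ) / (r / 4) := hv.le_of_nonpos_on_closedBall (by positivity) (fun x hx ↦
            hv0 x ⟨hcsub hx, by
              rw [mem_closedBall] at hx ⊢
              linarith [dist_triangle x c a, dist_triangle c b a, dist_comm c b,
                dist_comm b a]⟩) hbc (by linarith [dist_triangle z a b])
        _ = 8 * δ / r := by field_simp; norm_num

lemma localHCPWith_closure_real {n : ℕ} {Ω : Set (EuclideanSpace ℝ (Fin n))} (hΩ : IsOpen Ω)
    (h : UniformInteriorSphere Ω) : LocalHCPWith (embRC '' closure Ω) (1 / 2) 2 := by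
  obtain ⟨ρ, hρ, hball⟩ := h.exists_closedBall
  refine ⟨128, by norm_num, min 1 ρ, lt_min one_pos hρ, min_le_left _ _, ?_⟩
  rintro _ ⟨a, ha, rfl⟩ r hr hrρ δ hδ _ z hz
  have hrρ' : r < ρ := hrρ.trans_le (min_le_right _ _)
  have hr1 : r < 1 := hrρ.trans_le (min_le_left _ _)
  refine siciakExt_le fun v hv hv0 ↦ ?_
  have hv0' : ∀ x ∈ closure Ω, dist x a ≤ r → v (embRC x) ≤ 0 := fun x hx hxa ↦
    hv0 _ ⟨⟨x, hx, rfl⟩, by rwa [mem_closedBall, dist_embRC]⟩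
  suffices hmain : v z ≤ 128 * √(δ / r) by
    refine hmain.trans ?_
    rw [Real.sqrt_div hδ.le, ← mul_div_assoc, Real.sqrt_eq_rpow δ, Real.rpow_two]
    gcongr
    exact Real.le_sqrt_of_sq_le (by nlinarith [pow_le_one₀ hr.le hr1.le (n := 3), pow_pos hr 3])
  have hscale : ∀ k m : ℝ, 0 ≤ m → k ≤ m ^ 2 → √(k * (δ / r)) ≤ m * √(δ / r) := fun k m hm hk ↦ by
    rw [← Real.sqrt_sq hm, ← Real.sqrt_mul (sq_nonneg m)]
    gcongr
  have hsq := Real.sqrt_nonneg (δ / r)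
  rcases closedBall_subset_or_exists_frontier hΩ ha (r / 2) with hsub | ⟨b, hb, hab, hsub⟩
  · calc v z ≤ 4 * √(δ / (r / 2)) := hv.le_four_mul_sqrt_of_nonpos_on_real_ball (by positivity)
          (fun x hx ↦ hv0' x (subset_closure (hsub hx)) (by rw [mem_closedBall] at hx; linarith))
          (b := a) (by rw [dist_self]; positivity) hδ hz
      _ = 4 * √(2 * (δ / r)) := by congr 2; field_simp
      _ ≤ 128 * √(δ / r) := by linarith [hscale 2 2 (by norm_num) (by norm_num)]
  obtain ⟨c, hbc, hcsub⟩ := hball b hb (r / 4) (by positivity) (by linarith)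
  have hbbound : ∀ z' : EuclideanSpace ℂ (Fin n), ∀ η, 0 < η → dist z' (embRC b) ≤ η →
      v z' ≤ 4 * √(η / (r / 4)) := fun z' η hη hz' ↦
    hv.le_four_mul_sqrt_of_nonpos_on_real_ball (by positivity) (fun x hx ↦
      hv0' x (hcsub hx) (by
        rw [mem_closedBall] at hx
        linarith [dist_triangle x c a, dist_triangle c b a, dist_comm c b, dist_comm b a]))
      hbc hη hz'
  set d := dist a b with hd
  have hdab : dist (embRC a) (embRC b) = d := dist_embRC a b
  obtain hlt | hle := lt_or_ge δ (d / 4)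
  · have hd0 : 0 < d := by linarith
    have key := hv.le_of_nonpos_on_real_ball_of_le (M := 4 * √(2 * d / (r / 4))) hd0
      (fun x hx ↦ hv0' x (hsub hx) (by rw [mem_closedBall] at hx; linarith))
      (fun z' hz' ↦ hbbound z' _ (by positivity) (by
        rw [mem_closedBall] at hz'
        linarith [dist_triangle z' (embRC a) (embRC b)])) hlt.le hz
    refine key.trans ?_
    have hM : √(2 * d / (r / 4)) * (δ / d) ≤ √(2 * (δ / r)) := by
      refine Real.le_sqrt_of_sq_le ?_
      rw [mul_pow, Real.sq_sqrt (by positivity)]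
      have : 2 * d / (r / 4) * (δ / d) ^ 2 = 2 * (δ / r) * (4 * δ / d) := by field_simp
      rw [this]
      refine mul_le_of_le_one_right (by positivity) ?_
      rw [div_le_one hd0]
      linarith
    calc 8 * (4 * √(2 * d / (r / 4))) * δ / d = 32 * (√(2 * d / (r / 4)) * (δ / d)) := by ring
      _ ≤ 32 * √(2 * (δ / r)) := by gcongr
      _ ≤ 128 * √(δ / r) := by linarith [hscale 2 2 (by norm_num) (by norm_num)]
  · calc v z ≤ 4 * √(5 * δ / (r / 4)) := hbbound z _ (by positivity)
          (by linarith [dist_triangle z (embRC a) (embRC b)])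
      _ = 4 * √(20 * (δ / r)) := by congr 2; field_simp; norm_num
      _ ≤ 128 * √(δ / r) := by linarith [hscale 20 5 (by norm_num) (by norm_num)]

/-- **Lemma (uniform interior sphere condition and local HCP).**
Let `Ω ⊆ 𝕂ⁿ` be a bounded domain satisfying the uniform interior sphere condition,
where `𝕂 = ℝ` or `𝕂 = ℂ`.
(a) If `𝕂 = ℂ`, then `Ω̄` has local HCP with the (optimal) Hölder exponent `μ = 1`
and of order `q = 1`.
(b) If `𝕂 = ℝ` and `ℝⁿ` is identified with `ℝⁿ + i·0 ⊆ ℂⁿ`, then `Ω̄` has local HCP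
with the (optimal) exponent `μ = 1/2` and of order `q = 2`. -/
theorem uniformInteriorSphere_localHCP (n : ℕ) :
    (∀ Ω : Set (EuclideanSpace ℂ (Fin n)),
      IsOpen Ω → IsConnected Ω → Bornology.IsBounded Ω →
      UniformInteriorSphere Ω →
      LocalHCPWith (closure Ω) 1 1) ∧
    (∀ Ω : Set (EuclideanSpace ℝ (Fin n)),
      IsOpen Ω → IsConnected Ω → Bornology.IsBounded Ω →
      UniformInteriorSphere Ω →
      LocalHCPWith (embRC '' closure Ω) (1 / 2) 2) := by
  exact ⟨fun _ hΩ _ _ h ↦ localHCPWith_closure_complex hΩ h,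
    fun _ hΩ _ _ h ↦ localHCPWith_closure_real hΩ h⟩
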